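/- For any 0 < ε₁ < 1 and 0 < ε₂ < 1, there exists d₀ = d₀(ε₁,ε₂) such that the following holds for each n ≥ d ≥ d₀. Suppose G is an n-vertex bipartite (ε₁, ε₂·d)-expander with minimum degree δ(G) ≥ d. Let log^{10} n ≤ D ≤ n/log^{10} n, (100/ε₁)·log³ n ≤ m ≤ log⁴ n and ℓ ≤ n/log^{10} n. Let A ⊆ V(G) satisfy |A| ≤ D/log³ n. Let F₁, F₂, F₃, F₄ ⊆ G − A be vertex disjoint subgraphs and v₁, v₂, v₃, v₄ be vertices such that, for each i ∈ {1,2,3,4}, F_i is a (D,m)-expansion of v_i. Then G − A contains vertex disjoint paths P and Q with ℓ ≤ length(P) + length(Q) ≤ ℓ + 20m such that both P and Q connect {v₁,v₂} to {v₃,v₄} (i.e. each of P and Q has one endpoint in {v₁,v₂} and the other in {v₃,v₄}). -/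

import Mathlib

open Real

namespace Balanced

variable {V : Type*}

/-- The external neighbourhood of a vertex set `X` in `G`. -/
def extNbr (G : SimpleGraph V) (X : Set V) : Set V := {v | v ∉ X ∧ ∃ u ∈ X, G.Adj u v}

/-- The Komlós–Szemerédi expansion function `ε(x, ε₁, k)`. -/
noncomputable def epsFn (ε₁ k x : ℝ) : ℝ :=
  if x < k / 5 then 0 else ε₁ / (Real.log (15 * x / k)) ^ 2

/-- `G` is an `(ε₁, k)`-expander. -/
def IsExpander (G : SimpleGraph V) (ε₁ k : ℝ) : Prop :=
  ∀ X : Set V, k / 2 ≤ (X.ncard : ℝ) → (X.ncard : ℝ) ≤ (Nat.card V : ℝ) / 2 →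
    epsFn ε₁ k (X.ncard : ℝ) * (X.ncard : ℝ) ≤ ((extNbr G X).ncard : ℝ)

/-- `G` is bipartite. -/
def IsBip (G : SimpleGraph V) : Prop := ∃ f : V → Bool, ∀ u v, G.Adj u v → f u ≠ f v

/-- The average degree `2|E(G)|/|V(G)|` of `G`. -/
noncomputable def avgDeg (G : SimpleGraph V) : ℝ :=
  2 * (Nat.card G.edgeSet : ℝ) / (Nat.card V : ℝ)

/-- The minimum degree of `G` is at least `d`. -/
def MinDegGE (G : SimpleGraph V) (d : ℝ) : Prop :=
  ∀ v : V, d ≤ ((G.neighborSet v).ncard : ℝ)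

/-- The support of a walk, as a set of vertices. -/
def suppSet {G : SimpleGraph V} {a b : V} (w : G.Walk a b) : Set V := {x | x ∈ w.support}

/-- `G` contains an `ℓ`-balanced subdivision `TK_k^(ℓ)` of the complete graph `K_k`:
there are `k` core vertices joined pairwise by internally vertex-disjoint paths of
length exactly `ℓ`, whose internal vertices avoid all core vertices. -/
def ContainsBalSub (G : SimpleGraph V) (k ℓ : ℕ) : Prop :=
  ∃ c : Fin k → V, Function.Injective c ∧
    ∃ P : ∀ i j : Fin k, i < j → G.Walk (c i) (c j),
      (∀ i j (h : i < j), (P i j h).IsPath ∧ (P i j h).length = ℓ) ∧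
      (∀ i j (h : i < j) (q : Fin k), c q ∈ (P i j h).support → q = i ∨ q = j) ∧
      (∀ i j (h : i < j) i' j' (h' : i' < j'), (i, j) ≠ (i', j') →
        ∀ x, x ∈ (P i j h).support → x ∈ (P i' j' h').support →
          (x = c i ∨ x = c j) ∧ (x = c i' ∨ x = c j'))

/-- The subgraph `F` of `G` is a `(D, m)`-expansion of the vertex `v`:
`|V(F)| = D` and every vertex of `F` is at distance at most `m` from `v` in `F`. -/
def IsExpansion (G : SimpleGraph V) (F : G.Subgraph) (v : V) (D m : ℝ) : Prop :=
  ∃ hv : v ∈ F.verts, ((F.verts.ncard : ℝ) = D ∧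
    ∀ u, ∀ hu : u ∈ F.verts, ∃ w : F.coe.Walk ⟨v, hv⟩ ⟨u, hu⟩, (w.length : ℝ) ≤ m)

/-- `G` contains a `(D, m, k)`-adjuster. -/
def HasAdjuster (G : SimpleGraph V) (D m : ℝ) (k : ℕ) : Prop :=
  ∃ (v₁ v₂ : V) (F₁ F₂ : G.Subgraph) (A : Set V),
    Disjoint A F₁.verts ∧ Disjoint A F₂.verts ∧ Disjoint F₁.verts F₂.verts ∧
    IsExpansion G F₁ v₁ D m ∧ IsExpansion G F₂ v₂ D m ∧
    (A.ncard : ℝ) ≤ 10 * m * (k : ℝ) ∧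
    ∃ ℓ : ℕ, ∀ i : ℕ, i ≤ k → ∃ w : G.Walk v₁ v₂, w.IsPath ∧
      w.length = ℓ + 2 * i ∧ ∀ x ∈ w.support, x ∈ A ∪ {v₁, v₂}

open Classical in
/-- `π(u, v, G)` for a connected bipartite graph `G`: `0` if `u = v`, `1` if `u, v`
lie in different classes of the bipartition (equivalently, are joined by an odd walk),
and `2` otherwise. -/
noncomputable def piVal (G : SimpleGraph V) (u v : V) : ℕ :=
  if u = v then 0 else if ∃ w : G.Walk u v, Odd w.length then 1 else 2

/-- The ball of radius `r` around `v` in the subgraph of `G` induced on `S`,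
viewed as a subset of `V`. -/
def ballIn (G : SimpleGraph V) (S : Set V) (v : V) (r : ℕ) : Set V :=
  {u | ∃ w : G.Walk v u, w.length ≤ r ∧ ∀ x ∈ w.support, x ∈ S}

/-- The ball of radius `r` around the set `Y` in the subgraph of `G` induced on `S`. -/
def ballSetIn (G : SimpleGraph V) (S : Set V) (Y : Set V) (r : ℕ) : Set V :=
  {u | ∃ y ∈ Y, ∃ w : G.Walk y u, w.length ≤ r ∧ ∀ x ∈ w.support, x ∈ S}

/-- `P 0, …, P (q-1)` are consecutive shortest paths from `v` in the vertex set `W`: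
each `P i` is a shortest path between its endpoints in the graph induced on
`(W \ ⋃_{j<i} V(P j)) ∪ {v}`. -/
def ConsecSP (G : SimpleGraph V) (v : V) (W : Set V) {q : ℕ}
    (P : Fin q → Σ u : V, G.Walk v u) : Prop :=
  ∀ i : Fin q,
    (∀ x ∈ suppSet (P i).2,
      x ∈ (W \ ⋃ (j : Fin q) (_ : j < i), suppSet (P j).2) ∪ {v}) ∧
    ((P i).2).IsPath ∧
    ∀ w' : G.Walk v (P i).1,
      (∀ x ∈ suppSet w',
        x ∈ (W \ ⋃ (j : Fin q) (_ : j < i), suppSet (P j).2) ∪ {v}) →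
      ((P i).2).length ≤ w'.length

/-- `v` is an end vertex of the path `p`. -/
def IsEnd (G : SimpleGraph V) (v : V) (p : Σ a b : V, G.Walk a b) : Prop :=
  v = p.1 ∨ v = p.2.1

/-- `t` is the subpath `p(v, r)` of `p` of length `r` having `v` as an end vertex. -/
def IsTrunc (G : SimpleGraph V) (r : ℕ) (p : Σ a b : V, G.Walk a b) (v : V)
    (t : Σ u : V, G.Walk v u) : Prop :=
  t.2.length = r ∧ ∃ (c : V) (w' : G.Walk t.1 c),
    (⟨v, c, t.2.append w'⟩ : Σ a b : V, G.Walk a b) = p ∨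
    (⟨v, c, t.2.append w'⟩ : Σ a b : V, G.Walk a b) = ⟨p.2.1, p.1, p.2.2.reverse⟩

section Helpers

open scoped Classical

/-- Every vertex of `T` is joined to `v` by a walk of length at most `r` inside `T`. -/
def Rooted (G : SimpleGraph V) (T : Finset V) (v : V) (r : ℕ) : Prop :=
  v ∈ T ∧ ∀ u ∈ T, ∃ w : G.Walk v u, w.length ≤ r ∧ ∀ x ∈ w.support, x ∈ T

lemma rooted_singleton (G : SimpleGraph V) (v : V) : Rooted G {v} v 0 := by
  refine ⟨by simp, fun u hu => ?_⟩
  obtain rfl : u = v := by simpa using hu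
  exact ⟨.nil, by simp, by simp⟩

/-- Any two vertices of `C` are joined by a walk of length at most `r` inside `C`. -/
def DiamLE (G : SimpleGraph V) (C : Finset V) (r : ℕ) : Prop :=
  ∀ x ∈ C, ∀ y ∈ C, ∃ w : G.Walk x y, w.length ≤ r ∧ ∀ z ∈ w.support, z ∈ C

lemma Rooted.diamLE {G : SimpleGraph V} {T : Finset V} {v : V} {r s : ℕ} (h : Rooted G T v r)
    (hs : 2 * r ≤ s) : DiamLE G T s := by
  intro x hx y hy
  obtain ⟨p, hp, hp'⟩ := h.2 x hx
  obtain ⟨q, hq, hq'⟩ := h.2 y hy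
  refine ⟨p.reverse.append q, ?_, fun z hz => ?_⟩
  · rw [SimpleGraph.Walk.length_append, SimpleGraph.Walk.length_reverse]
    omega
  · rw [SimpleGraph.Walk.mem_support_append_iff, SimpleGraph.Walk.support_reverse,
      List.mem_reverse] at hz
    exact hz.elim (hp' z) (hq' z)

lemma isPath_append {G : SimpleGraph V} {a b c : V} {p : G.Walk a b} {q : G.Walk b c}
    (hp : p.IsPath) (hq : q.IsPath) (h : ∀ x ∈ p.support, x ∈ q.support → x = b) :
    (p.append q).IsPath := by
  rw [SimpleGraph.Walk.isPath_def, SimpleGraph.Walk.support_append, List.nodup_append]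
  have hq' := hq.support_nodup
  rw [← SimpleGraph.Walk.cons_tail_support, List.nodup_cons] at hq'
  refine ⟨hp.support_nodup, hq'.2, fun x hx y hy hxy => ?_⟩
  subst hxy
  have := h x hx (List.mem_of_mem_tail hy)
  subst this
  exact hq'.1 hy

/-- The distance from `v` to `u` inside `T`. -/
noncomputable def distIn (G : SimpleGraph V) (T : Finset V) (v u : V) : ℕ :=
  sInf {k | ∃ w : G.Walk v u, w.length = k ∧ ∀ x ∈ w.support, x ∈ T}

lemma distIn_le {G : SimpleGraph V} {T : Finset V} {v u : V} (w : G.Walk v u)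
    (hw : ∀ x ∈ w.support, x ∈ T) : distIn G T v u ≤ w.length :=
  Nat.sInf_le ⟨w, rfl, hw⟩

lemma Rooted.exists_walk_length_eq {G : SimpleGraph V} {T : Finset V} {v : V} {r : ℕ}
    (h : Rooted G T v r) {u : V} (hu : u ∈ T) :
    distIn G T v u ≤ r ∧
      ∃ w : G.Walk v u, w.length = distIn G T v u ∧ ∀ x ∈ w.support, x ∈ T := by
  obtain ⟨w, hw, hs⟩ := h.2 u hu
  exact ⟨(distIn_le w hs).trans hw,
    Nat.sInf_mem (s := {k | ∃ w : G.Walk v u, w.length = k ∧ ∀ x ∈ w.support, x ∈ T})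
      ⟨_, w, rfl, hs⟩⟩

lemma Rooted.exists_erase {G : SimpleGraph V} {T : Finset V} {v : V} {r : ℕ}
    (h : Rooted G T v r) (hne : ∃ x ∈ T, x ≠ v) : ∃ y ∈ T, y ≠ v ∧ Rooted G (T.erase y) v r := by
  obtain ⟨y, hy, hmax⟩ := T.exists_max_image (distIn G T v) ⟨v, h.1⟩
  have hyv : y ≠ v := by
    rintro rfl
    obtain ⟨x, hx, hxy⟩ := hne
    obtain ⟨-, w, hw, -⟩ := h.exists_walk_length_eq hx
    have h0 : distIn G T y y ≤ 0 := distIn_le .nil (by simpa using hy)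
    have := hmax x hx
    exact hxy (SimpleGraph.Walk.eq_of_length_eq_zero (p := w) (by omega)).symm
  refine ⟨y, hy, hyv, by simp [h.1, hyv.symm], fun u hu => ?_⟩
  rw [Finset.mem_erase] at hu
  obtain ⟨hr, w, hw, hs⟩ := h.exists_walk_length_eq hu.2
  refine ⟨w, hw.trans_le hr, fun x hx => Finset.mem_erase.2 ⟨?_, hs x hx⟩⟩
  rintro rfl
  have h1 := distIn_le (w.takeUntil x hx)
    (fun z hz => hs z (w.support_takeUntil_subset_support hx hz))
  have h2 := SimpleGraph.Walk.length_takeUntil_lt_length hx hu.1.symm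
  have := hmax u hu.2
  omega

lemma Rooted.exists_subset_card {G : SimpleGraph V} {v : V} {r k : ℕ} (hk : 1 ≤ k) :
    ∀ (j : ℕ) {T : Finset V}, T.card = k + j → Rooted G T v r →
      ∃ T' ⊆ T, T'.card = k ∧ Rooted G T' v r
  | 0, T, hT, h => ⟨T, subset_rfl, hT, h⟩
  | j + 1, T, hT, h => by
    obtain ⟨x, hx, hxv⟩ := Finset.exists_mem_ne (by omega : 1 < T.card) v
    obtain ⟨y, hy, -, hr⟩ := h.exists_erase ⟨x, hx, hxv⟩
    obtain ⟨T', h1, h2, h3⟩ := Rooted.exists_subset_card hk j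
      (by rw [Finset.card_erase_of_mem hy]; omega) hr
    exact ⟨T', h1.trans (Finset.erase_subset _ _), h2, h3⟩

/-- A parent function of a spanning tree of `T` rooted at `v` with depth at most `r`. -/
structure IsParent (G : SimpleGraph V) (T : Finset V) (v : V) (r : ℕ) (par : V → V) : Prop where
  root : par v = v
  mem : ∀ u ∈ T, par u ∈ T
  iter : ∀ u ∈ T, par^[r] u = v
  adj : ∀ u ∈ T, u ≠ v → G.Adj u (par u)

lemma Rooted.exists_isParent {G : SimpleGraph V} {T : Finset V} {v : V} {r : ℕ}
    (h : Rooted G T v r) : ∃ par, IsParent G T v r par := by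
  have key : ∀ u, ∃ p, (u = v → p = v) ∧
      (u ∈ T → u ≠ v → p ∈ T ∧ G.Adj u p ∧ distIn G T v p < distIn G T v u) := by
    intro u
    by_cases huv : u = v
    · exact ⟨v, fun _ => rfl, fun _ h => absurd huv h⟩
    by_cases hu : u ∈ T
    · obtain ⟨-, w, hw, hs⟩ := h.exists_walk_length_eq hu
      obtain ⟨p, q, hadj, hwq⟩ : ∃ (p : V) (q : G.Walk v p) (hadj : G.Adj p u), w = q.concat hadj := by
        cases w with
        | nil => exact absurd rfl huv
        | cons hh ww => exact SimpleGraph.Walk.exists_cons_eq_concat hh ww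
      subst hwq
      have hqs : ∀ x ∈ q.support, x ∈ T := fun x hx => hs x (by
        rw [SimpleGraph.Walk.support_concat]; simp [hx])
      refine ⟨p, fun h => absurd h huv, fun _ _ => ⟨hqs p q.end_mem_support, hadj.symm, ?_⟩⟩
      have := distIn_le q hqs
      rw [SimpleGraph.Walk.length_concat] at hw
      omega
    · exact ⟨v, fun h => absurd h huv, fun h => absurd h hu⟩
  choose par h1 h2 using key
  have hroot : par v = v := h1 v rfl
  have hmem : ∀ u ∈ T, par u ∈ T := by
    intro u hu
    by_cases huv : u = v
    · rw [huv, hroot]; exact h.1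
    · exact (h2 u hu huv).1
  refine ⟨par, hroot, hmem, ?_, fun u hu huv => (h2 u hu huv).2.1⟩
  have main : ∀ k, ∀ u ∈ T, distIn G T v u ≤ k → par^[k] u = v := by
    intro k
    induction k with
    | zero =>
      intro u hu hk
      obtain ⟨-, w, hw, -⟩ := h.exists_walk_length_eq hu
      exact (SimpleGraph.Walk.eq_of_length_eq_zero (p := w) (by omega)).symm
    | succ k ih =>
      intro u hu hk
      rw [Function.iterate_succ_apply]
      by_cases huv : u = v
      · subst huv
        rw [hroot]
        exact Function.iterate_fixed hroot k
      · have := h2 u hu huv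
        exact ih _ this.1 (by omega)
  exact fun u hu => main r u hu (h.exists_walk_length_eq hu).1

lemma IsParent.iterate_mem {G : SimpleGraph V} {T : Finset V} {v : V} {r : ℕ} {par : V → V}
    (h : IsParent G T v r par) {u : V} (hu : u ∈ T) : ∀ k, par^[k] u ∈ T
  | 0 => hu
  | k + 1 => by
    rw [Function.iterate_succ_apply']
    exact h.mem _ (h.iterate_mem hu k)

lemma IsParent.iterate_of_le {G : SimpleGraph V} {T : Finset V} {v : V} {r : ℕ} {par : V → V}
    (h : IsParent G T v r par) {u : V} (hu : u ∈ T) {k : ℕ} (hk : r ≤ k) : par^[k] u = v := by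
  obtain ⟨j, rfl⟩ := Nat.exists_eq_add_of_le' hk
  rw [Function.iterate_add_apply, h.iter u hu]
  exact Function.iterate_fixed h.root j

lemma IsParent.exists_walk {G : SimpleGraph V} {T : Finset V} {v : V} {r : ℕ} {par : V → V}
    (h : IsParent G T v r par) : ∀ (k : ℕ) {u : V}, u ∈ T →
      ∃ w : G.Walk u (par^[k] u), w.length ≤ k ∧ ∀ x ∈ w.support, ∃ i ≤ k, x = par^[i] u
  | 0, u, _ => ⟨.nil, le_rfl, fun x hx => ⟨0, le_rfl, by simpa using hx⟩⟩
  | k + 1, u, hu => by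
    obtain ⟨w, hw, hs⟩ := h.exists_walk k (h.mem u hu)
    by_cases huv : u = v
    · subst huv
      rw [Function.iterate_fixed h.root]
      exact ⟨.nil, by simp, fun x hx => ⟨0, by simp, by simpa using hx⟩⟩
    · refine ⟨.cons (h.adj u hu huv) w, by simpa using hw, fun x hx => ?_⟩
      have hx : x ∈ u :: w.support := hx
      rcases List.mem_cons.1 hx with rfl | hx
      · exact ⟨0, by simp, rfl⟩
      · obtain ⟨i, hi, rfl⟩ := hs x hx
        exact ⟨i + 1, by omega, rfl⟩

/-- The descendants of the vertices of `Y` in the tree on `T` with parent function `par`. -/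
noncomputable def descendants (T : Finset V) (par : V → V) (Y : Finset V) : Finset V :=
  T.filter fun u => ∃ i, par^[i] u ∈ Y

lemma IsParent.exists_heavy {G : SimpleGraph V} {T : Finset V} {v : V} {r : ℕ} {par : V → V}
    (h : IsParent G T v r par) (hv : v ∈ T) :
    ∃ stem ⊆ T, v ∈ stem ∧ stem.card ≤ r + 1 ∧
      ∀ y ∉ stem, 2 * (descendants T par {y}).card ≤ T.card := by
  set heavy := T.filter fun z => T.card < 2 * (descendants T par {z}).card with hheavy
  have hvh : v ∈ heavy := by
    have : descendants T par {v} = T := by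
      refine Finset.filter_true_of_mem fun u hu => ⟨r, ?_⟩
      rw [Finset.mem_singleton, h.iter u hu]
    have hpos : 0 < T.card := Finset.card_pos.2 ⟨v, hv⟩
    rw [hheavy, Finset.mem_filter, this]
    exact ⟨hv, by omega⟩
  obtain ⟨z, hz, hmin⟩ := heavy.exists_min_image (fun z => (descendants T par {z}).card) ⟨v, hvh⟩
  rw [hheavy, Finset.mem_filter] at hz
  have hanc : ∀ k, par^[k] z ∈ (Finset.range (r + 1)).image fun i => par^[i] z := by
    intro k
    rw [Finset.mem_image]
    rcases le_total k r with hk | hk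
    · exact ⟨k, by simpa using Nat.lt_succ_of_le hk, rfl⟩
    · exact ⟨r, by simp, by rw [h.iter z hz.1, h.iterate_of_le hz.1 hk]⟩
  refine ⟨(Finset.range (r + 1)).image fun i => par^[i] z, ?_, ?_, ?_, ?_⟩
  · intro x hx
    obtain ⟨i, -, rfl⟩ := Finset.mem_image.1 hx
    exact h.iterate_mem hz.1 i
  · have := hanc r
    rwa [h.iter z hz.1] at this
  · exact Finset.card_image_le.trans (by simp)
  · intro y hy
    by_contra! hlt
    have hsy : descendants T par {y} ⊆ T := Finset.filter_subset _ _
    have hsz : descendants T par {z} ⊆ T := Finset.filter_subset _ _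
    have hinter : (descendants T par {y} ∩ descendants T par {z}).Nonempty := by
      rw [Finset.nonempty_iff_ne_empty]
      intro hempty
      have h1 := Finset.card_union_of_disjoint (Finset.disjoint_iff_inter_eq_empty.2 hempty)
      have h2 := Finset.card_le_card (Finset.union_subset hsy hsz)
      omega
    obtain ⟨u, hu⟩ := hinter
    simp only [descendants, Finset.mem_inter, Finset.mem_filter, Finset.mem_singleton] at hu
    obtain ⟨⟨huT, i, hi⟩, -, j, hj⟩ := hu
    rcases le_total j i with hij | hij
    · obtain ⟨k, rfl⟩ := Nat.exists_eq_add_of_le' hij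
      rw [Function.iterate_add_apply, hj] at hi
      exact hy (hi ▸ hanc k)
    · obtain ⟨k, rfl⟩ := Nat.exists_eq_add_of_le' hij
      rw [Function.iterate_add_apply, hi] at hj
      have hyT : y ∈ T := hi ▸ h.iterate_mem huT i
      have hsub : descendants T par {y} ⊆ descendants T par {z} := by
        intro x hx
        simp only [descendants, Finset.mem_filter, Finset.mem_singleton] at hx ⊢
        obtain ⟨hxT, l, rfl⟩ := hx
        exact ⟨hxT, k + l, by rw [Function.iterate_add_apply, hj]⟩
      have heq := Finset.eq_of_subset_of_card_le hsub
        (hmin y (by rw [hheavy, Finset.mem_filter]; exact ⟨hyT, hlt⟩))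
      have hzz : z ∈ descendants T par {z} := by
        simp only [descendants, Finset.mem_filter, Finset.mem_singleton]
        exact ⟨hz.1, 0, rfl⟩
      rw [← heq] at hzz
      simp only [descendants, Finset.mem_filter, Finset.mem_singleton] at hzz
      obtain ⟨-, l, hl⟩ := hzz
      exact hy (hl ▸ hanc l)

lemma IsParent.exists_split {G : SimpleGraph V} {T Y stem : Finset V} {v v' : V} {r r' K : ℕ}
    {par : V → V} (h : IsParent G T v r par) (hv : v ∈ T) (hvstem : v ∈ stem)
    (hstem : ∀ y ∉ stem, 2 * (descendants T par {y}).card ≤ T.card)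
    (hY : Rooted G Y v' r') (hYstem : Disjoint Y stem) (hv' : v' ∉ T) (hK : 2 ≤ K)
    (hKY : K ≤ Y.card) :
    ∃ T₁ T₂ : Finset V, Disjoint T₁ T₂ ∧ T₁ ⊆ T ∧ T₂ ⊆ Y ∪ T ∧ Rooted G T₁ v r ∧
      Rooted G T₂ v' (r' + r) ∧ K ≤ T₂.card ∧ T.card ≤ 2 * T₁.card + 2 * K := by
  obtain ⟨Z, hZ, hmin⟩ := (Y.powerset.filter fun Z =>
      Rooted G Z v' r' ∧ K ≤ (Z ∪ descendants T par Z).card).exists_min_image Finset.card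
    ⟨Y, by
      simp only [Finset.mem_filter, Finset.mem_powerset, subset_rfl, true_and]
      exact ⟨hY, hKY.trans (Finset.card_le_card Finset.subset_union_left)⟩⟩
  simp only [Finset.mem_filter, Finset.mem_powerset] at hZ hmin
  obtain ⟨hZY, hZr, hZK⟩ := hZ
  have hZstem : Disjoint Z stem := Finset.disjoint_of_subset_left hZY hYstem
  have hne : ∃ x ∈ Z, x ≠ v' := by
    by_contra! hall
    have hZs : Z = {v'} := Finset.eq_singleton_iff_unique_mem.2 ⟨hZr.1, hall⟩
    have hemp : descendants T par Z = ∅ := by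
      rw [descendants, Finset.filter_eq_empty_iff]
      rintro u hu ⟨i, hi⟩
      rw [hZs, Finset.mem_singleton] at hi
      exact hv' (hi ▸ h.iterate_mem hu i)
    rw [hemp, hZs] at hZK
    simp at hZK
    omega
  obtain ⟨y, hy, -, hry⟩ := hZr.exists_erase hne
  have hlt : ((Z.erase y) ∪ descendants T par (Z.erase y)).card < K := by
    by_contra! hge
    have := hmin (Z.erase y) ⟨(Finset.erase_subset _ _).trans hZY, hry, hge⟩
    rw [Finset.card_erase_of_mem hy] at this
    have : 0 < Z.card := Finset.card_pos.2 ⟨y, hy⟩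
    omega
  have hdsub : descendants T par Z ⊆ descendants T par (Z.erase y) ∪ descendants T par {y} := by
    intro u hu
    simp only [descendants, Finset.mem_union, Finset.mem_filter, Finset.mem_singleton,
      Finset.mem_erase] at hu ⊢
    obtain ⟨huT, i, hi⟩ := hu
    by_cases hiy : par^[i] u = y
    · exact Or.inr ⟨huT, i, hiy⟩
    · exact Or.inl ⟨huT, i, hiy, hi⟩
  have hdT : descendants T par Z ⊆ T := Finset.filter_subset _ _
  have hcard : 2 * (descendants T par Z).card ≤ T.card + 2 * K := by
    have h1 := (Finset.card_le_card hdsub).trans (Finset.card_union_le _ _)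
    have h2 := hstem y (Finset.disjoint_left.1 hZstem hy)
    have h3 : (descendants T par (Z.erase y)).card ≤
      ((Z.erase y) ∪ descendants T par (Z.erase y)).card :=
        Finset.card_le_card Finset.subset_union_right
    omega
  have hmem : ∀ {u}, u ∈ descendants T par Z ↔ u ∈ T ∧ ∃ i, par^[i] u ∈ Z := by
    intro u
    simp [descendants]
  have hvZ : ∀ i, par^[i] v ∉ Z := fun i hi => by
    rw [Function.iterate_fixed h.root] at hi
    exact Finset.disjoint_left.1 hZstem hi hvstem
  refine ⟨T \ descendants T par Z, Z ∪ descendants T par Z, ?_, Finset.sdiff_subset,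
    Finset.union_subset_union hZY hdT, ⟨?_, ?_⟩, ⟨?_, ?_⟩, hZK, ?_⟩
  · rw [Finset.disjoint_left]
    intro u hu hu'
    rw [Finset.mem_sdiff] at hu
    rcases Finset.mem_union.1 hu' with hu' | hu'
    · exact hu.2 (hmem.2 ⟨hu.1, 0, hu'⟩)
    · exact hu.2 hu'
  · rw [Finset.mem_sdiff, hmem]
    exact ⟨hv, fun ⟨_, i, hi⟩ => hvZ i hi⟩
  · intro u hu
    rw [Finset.mem_sdiff, hmem] at hu
    have hwalk := h.exists_walk r hu.1
    rw [h.iter u hu.1] at hwalk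
    obtain ⟨w, hw, hs⟩ := hwalk
    refine ⟨w.reverse, by simpa using hw, fun x hx => ?_⟩
    obtain ⟨i, -, rfl⟩ := hs x (by simpa using hx)
    rw [Finset.mem_sdiff, hmem]
    refine ⟨h.iterate_mem hu.1 i, fun ⟨_, j, hj⟩ => hu.2 ⟨hu.1, j + i, ?_⟩⟩
    rwa [Function.iterate_add_apply]
  · exact Finset.mem_union_left _ hZr.1
  · intro u hu
    by_cases huZ : u ∈ Z
    · obtain ⟨w, hw, hs⟩ := hZr.2 u huZ
      exact ⟨w, by omega, fun x hx => Finset.mem_union_left _ (hs x hx)⟩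
    have hu' := (Finset.mem_union.1 hu).resolve_left huZ
    obtain ⟨huT, i, hi⟩ := hmem.1 hu'
    have hir : i ≤ r := by
      by_contra! hlt
      rw [h.iterate_of_le huT hlt.le] at hi
      exact hvZ 0 hi
    obtain ⟨w, hw, hs⟩ := h.exists_walk i huT
    obtain ⟨q, hq, hqs⟩ := hZr.2 _ hi
    refine ⟨q.append w.reverse, ?_, fun x hx => ?_⟩
    · rw [SimpleGraph.Walk.length_append, SimpleGraph.Walk.length_reverse]
      omega
    · rw [SimpleGraph.Walk.mem_support_append_iff, SimpleGraph.Walk.support_reverse,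
        List.mem_reverse] at hx
      rcases hx with hx | hx
      · exact Finset.mem_union_left _ (hqs x hx)
      · obtain ⟨j, hj, rfl⟩ := hs x hx
        refine Finset.mem_union_right _ (hmem.2 ⟨h.iterate_mem huT j, i - j, ?_⟩)
        rwa [← Function.iterate_add_apply, Nat.sub_add_cancel hj]
  · have := Finset.card_sdiff_add_card_eq_card hdT
    omega

section Growth

/-- The vertices of `W` outside `X` with a neighbour in `X`. -/
noncomputable def nbIn (G : SimpleGraph V) (W X : Finset V) : Finset V :=
  W.filter fun u => u ∉ X ∧ ∃ w ∈ X, G.Adj w u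

lemma mem_nbIn {G : SimpleGraph V} {W X : Finset V} {u : V} :
    u ∈ nbIn G W X ↔ u ∈ W ∧ u ∉ X ∧ ∃ w ∈ X, G.Adj w u := by
  simp [nbIn]

/-- The set of vertices reached from `X` in at most `i` steps inside `W`. -/
noncomputable def ballFrom (G : SimpleGraph V) (W X : Finset V) : ℕ → Finset V
  | 0 => X
  | i + 1 => ballFrom G W X i ∪ nbIn G W (ballFrom G W X i)

lemma subset_ballFrom (G : SimpleGraph V) (W X : Finset V) : ∀ i, X ⊆ ballFrom G W X i
  | 0 => subset_rfl
  | i + 1 => (subset_ballFrom G W X i).trans Finset.subset_union_left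

lemma ballFrom_subset (G : SimpleGraph V) (W X : Finset V) : ∀ i, ballFrom G W X i ⊆ X ∪ W
  | 0 => Finset.subset_union_left
  | i + 1 => Finset.union_subset (ballFrom_subset G W X i)
      ((Finset.filter_subset _ _).trans Finset.subset_union_right)

lemma exists_walk_of_mem_ballFrom {G : SimpleGraph V} {W X : Finset V} :
    ∀ {i : ℕ} {u : V}, u ∈ ballFrom G W X i → ∃ x ∈ X, ∃ w : G.Walk x u,
      w.length ≤ i ∧ ∀ z ∈ w.support, z ∈ ballFrom G W X i
  | 0, u, hu => ⟨u, hu, .nil, le_rfl, fun z hz => by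
      obtain rfl : z = u := by simpa using hz
      exact hu⟩
  | i + 1, u, hu => by
    rcases Finset.mem_union.1 hu with hu | hu'
    · obtain ⟨x, hx, w, hw, hs⟩ := exists_walk_of_mem_ballFrom hu
      exact ⟨x, hx, w, by omega, fun z hz => Finset.mem_union_left _ (hs z hz)⟩
    · obtain ⟨-, -, y, hy, hadj⟩ := mem_nbIn.1 hu'
      obtain ⟨x, hx, w, hw, hs⟩ := exists_walk_of_mem_ballFrom hy
      refine ⟨x, hx, w.concat hadj, by rw [SimpleGraph.Walk.length_concat]; omega,
        fun z hz => ?_⟩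
      rw [SimpleGraph.Walk.support_concat, List.mem_append, List.mem_singleton] at hz
      rcases hz with hz | rfl
      · exact Finset.mem_union_left _ (hs z hz)
      · exact hu

lemma Rooted.ballFrom {G : SimpleGraph V} {T : Finset V} {v : V} {r : ℕ} (h : Rooted G T v r)
    (W : Finset V) (i : ℕ) : Rooted G (ballFrom G W T i) v (r + i) := by
  refine ⟨subset_ballFrom G W T i h.1, fun u hu => ?_⟩
  obtain ⟨x, hx, w, hw, hs⟩ := exists_walk_of_mem_ballFrom hu
  obtain ⟨p, hp, hps⟩ := h.2 x hx
  refine ⟨p.append w, by rw [SimpleGraph.Walk.length_append]; omega, fun z hz => ?_⟩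
  rw [SimpleGraph.Walk.mem_support_append_iff] at hz
  exact hz.elim (fun hz => subset_ballFrom G W T i (hps z hz)) (hs z)

lemma Rooted.exists_disjoint_growth {G : SimpleGraph V} {F₁ F₂ W : Finset V} {v₁ v₂ : V} {r : ℕ}
    (h₁ : Rooted G F₁ v₁ r) (h₂ : Rooted G F₂ v₂ r) (hF : Disjoint F₁ F₂) :
    ∀ i, ∃ T₁ T₂ : Finset V, Disjoint T₁ T₂ ∧ F₁ ⊆ T₁ ∧ F₂ ⊆ T₂ ∧
      T₁ ∪ T₂ = Balanced.ballFrom G W (F₁ ∪ F₂) i ∧ Rooted G T₁ v₁ (r + i) ∧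
      Rooted G T₂ v₂ (r + i) := by
  have grow : ∀ {T N : Finset V} {v : V} {s : ℕ}, Rooted G T v s →
      (∀ u ∈ N, ∃ w ∈ T, G.Adj w u) → Rooted G (T ∪ N) v (s + 1) := by
    intro T N v s hT hN
    refine ⟨Finset.mem_union_left _ hT.1, fun u hu => ?_⟩
    by_cases huT : u ∈ T
    · obtain ⟨w, hw, hs⟩ := hT.2 u huT
      exact ⟨w, by omega, fun x hx => Finset.mem_union_left _ (hs x hx)⟩
    · obtain ⟨y, hy, hadj⟩ := hN u ((Finset.mem_union.1 hu).resolve_left huT)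
      obtain ⟨w, hw, hs⟩ := hT.2 y hy
      refine ⟨w.concat hadj, by rw [SimpleGraph.Walk.length_concat]; omega, fun x hx => ?_⟩
      rw [SimpleGraph.Walk.support_concat, List.mem_append, List.mem_singleton] at hx
      rcases hx with hx | rfl
      · exact Finset.mem_union_left _ (hs x hx)
      · exact hu
  intro i
  induction i with
  | zero => exact ⟨F₁, F₂, hF, subset_rfl, subset_rfl, rfl, h₁, h₂⟩
  | succ i ih =>
    obtain ⟨T₁, T₂, hT, hF₁, hF₂, hball, hT₁, hT₂⟩ := ih
    set N := nbIn G W (T₁ ∪ T₂) with hN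
    set N₁ := N.filter fun u => ∃ w ∈ T₁, G.Adj w u with hN₁
    have hNT : ∀ u ∈ N, u ∉ T₁ ∧ u ∉ T₂ := fun u hu => by
      simpa [not_or] using (mem_nbIn.1 hu).2.1
    have hN₁N : N₁ ⊆ N := Finset.filter_subset _ _
    refine ⟨T₁ ∪ N₁, T₂ ∪ (N \ N₁), ?_, hF₁.trans Finset.subset_union_left,
      hF₂.trans Finset.subset_union_left, ?_, grow hT₁ fun u hu => (Finset.mem_filter.1 hu).2,
      grow hT₂ fun u hu => ?_⟩
    · rw [Finset.disjoint_left] at hT ⊢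
      intro u hu hu'
      rw [Finset.mem_union] at hu hu'
      rw [Finset.mem_sdiff] at hu'
      rcases hu with hu | hu <;> rcases hu' with hu' | hu'
      · exact hT hu hu'
      · exact (hNT u hu'.1).1 hu
      · exact (hNT u (hN₁N hu)).2 hu'
      · exact hu'.2 hu
    · rw [Balanced.ballFrom, ← hball, ← hN, Finset.union_union_union_comm,
        Finset.union_sdiff_of_subset hN₁N]
    · rw [Finset.mem_sdiff] at hu
      obtain ⟨-, -, w, hw, hadj⟩ := mem_nbIn.1 hu.1
      rcases Finset.mem_union.1 hw with hw | hw
      · exact absurd (Finset.mem_filter.2 ⟨hu.1, w, hw, hadj⟩) hu.2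
      · exact ⟨w, hw, hadj⟩

lemma Rooted.exists_path {G : SimpleGraph V} {T : Finset V} {v u : V} {r : ℕ}
    (h : Rooted G T v r) (hu : u ∈ T) :
    ∃ w : G.Walk v u, w.IsPath ∧ w.length ≤ r ∧ ∀ x ∈ w.support, x ∈ T := by
  obtain ⟨w, hw, hs⟩ := h.2 u hu
  exact ⟨w.bypass, w.bypass_isPath, w.length_bypass_le_length.trans hw,
    fun x hx => hs x (w.support_bypass_subset_support hx)⟩

variable [Fintype V]

lemma lt_card_ballFrom {G : SimpleGraph V} {W X : Finset V} {c : ℝ} {M τ : ℕ} (hc : 0 < c)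
    (hX : X.Nonempty) (hτ : (Fintype.card V : ℝ) < (1 + c) ^ τ)
    (hstep : ∀ Y, X ⊆ Y → Y ⊆ X ∪ W → Y.card ≤ M → c * Y.card ≤ (nbIn G W Y).card) :
    M < (ballFrom G W X τ).card := by
  have key : ∀ i, M < (ballFrom G W X i).card ∨ (1 + c) ^ i ≤ ((ballFrom G W X i).card : ℝ) := by
    intro i
    induction i with
    | zero =>
      right
      rw [pow_zero]
      exact_mod_cast Finset.card_pos.2 hX
    | succ i ih =>
      have hcard : (ballFrom G W X (i + 1)).card =
          (ballFrom G W X i).card + (nbIn G W (ballFrom G W X i)).card := by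
        refine Finset.card_union_of_disjoint (Finset.disjoint_left.2 fun u hu hu' => ?_)
        exact (mem_nbIn.1 hu').2.1 hu
      by_cases hM : M < (ballFrom G W X i).card
      · left; omega
      · right
        have h1 := hstep _ (subset_ballFrom G W X i) (ballFrom_subset G W X i) (not_lt.1 hM)
        have h2 := ih.resolve_left hM
        rw [hcard, pow_succ]
        push_cast
        nlinarith
  refine (key τ).resolve_right fun h => ?_
  have : ((ballFrom G W X τ).card : ℝ) ≤ Fintype.card V := by exact_mod_cast Finset.card_le_univ _
  linarith

/-- Every nonempty set of at most half of the vertices expands by a factor `e`. -/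
def Expands (G : SimpleGraph V) (e : ℝ) : Prop :=
  ∀ X : Finset V, X.Nonempty → 2 * X.card ≤ Fintype.card V →
    e * X.card ≤ (nbIn G Finset.univ X).card

lemma Expands.le_card_nbIn_add {G : SimpleGraph V} {e : ℝ} (hE : Expands G e) {X : Finset V}
    (W : Finset V) (hX : X.Nonempty) (hX' : 2 * X.card ≤ Fintype.card V) :
    e * X.card ≤ (nbIn G W X).card + (Wᶜ).card := by
  refine (hE X hX hX').trans ?_
  have : nbIn G Finset.univ X ⊆ nbIn G W X ∪ Wᶜ := by
    intro u hu
    rw [Finset.mem_union, Finset.mem_compl]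
    by_cases huW : u ∈ W
    · exact Or.inl (mem_nbIn.2 ⟨huW, (mem_nbIn.1 hu).2⟩)
    · exact Or.inr huW
  exact_mod_cast (Finset.card_le_card this).trans (Finset.card_union_le _ _)

lemma Expands.lt_two_mul_card_ballFrom {G : SimpleGraph V} {e : ℝ} (hE : Expands G e) (he : 0 < e)
    {τ : ℕ} (hτ : (Fintype.card V : ℝ) < (1 + e / 2) ^ τ) {W X : Finset V} (hX : X.Nonempty)
    (hW : 2 * ((Wᶜ).card : ℝ) ≤ e * X.card) :
    Fintype.card V < 2 * (ballFrom G W X τ).card := by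
  have := lt_card_ballFrom (G := G) (W := W) (M := Fintype.card V / 2) (half_pos he) hX hτ ?_
  · omega
  intro Y hXY _ hY
  have h1 := hE.le_card_nbIn_add W (hX.mono hXY) (by omega)
  have h2 : (X.card : ℝ) ≤ Y.card := by exact_mod_cast Finset.card_le_card hXY
  have h3 := mul_le_mul_of_nonneg_left h2 he.le
  linarith

lemma Expands.exists_connecting_path {G : SimpleGraph V} {e : ℝ} (hE : Expands G e) (he : 0 < e)
    {τ : ℕ} (hτ : (Fintype.card V : ℝ) < (1 + e / 2) ^ τ) {W X Y : Finset V}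
    (hX : X.Nonempty) (hY : Y.Nonempty) (hXW : X ⊆ W) (hYW : Y ⊆ W)
    (hWX : 2 * ((Wᶜ).card : ℝ) ≤ e * X.card) (hWY : 2 * ((Wᶜ).card : ℝ) ≤ e * Y.card) :
    ∃ x ∈ X, ∃ y ∈ Y, ∃ w : G.Walk x y, w.IsPath ∧ w.length ≤ 2 * τ ∧
      (∀ z ∈ w.support, z ∈ W) ∧ (∀ z ∈ w.support, z ∈ X → z = x) ∧
      ∀ z ∈ w.support, z ∈ Y → z = y := by
  have h1 := hE.lt_two_mul_card_ballFrom he hτ hX hWX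
  have h2 := hE.lt_two_mul_card_ballFrom he hτ hY hWY
  have hinter : ∃ u, u ∈ ballFrom G W X τ ∧ u ∈ ballFrom G W Y τ := by
    by_contra! hno
    have := Finset.card_union_of_disjoint (Finset.disjoint_left.2 hno)
    have := Finset.card_le_univ (ballFrom G W X τ ∪ ballFrom G W Y τ)
    omega
  have hex : ∃ k, ∃ x ∈ X, ∃ y ∈ Y, ∃ w : G.Walk x y, w.length = k ∧ ∀ z ∈ w.support, z ∈ W := by
    obtain ⟨u, huX, huY⟩ := hinter
    obtain ⟨x, hx, p, -, hps⟩ := exists_walk_of_mem_ballFrom huX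
    obtain ⟨y, hy, q, -, hqs⟩ := exists_walk_of_mem_ballFrom huY
    refine ⟨_, x, hx, y, hy, p.append q.reverse, rfl, fun z hz => ?_⟩
    rw [SimpleGraph.Walk.mem_support_append_iff, SimpleGraph.Walk.support_reverse,
      List.mem_reverse] at hz
    rcases hz with hz | hz
    · exact Finset.union_subset hXW subset_rfl (ballFrom_subset G W X τ (hps z hz))
    · exact Finset.union_subset hYW subset_rfl (ballFrom_subset G W Y τ (hqs z hz))
  have hle : Nat.find hex ≤ 2 * τ := by
    obtain ⟨u, huX, huY⟩ := hinter
    obtain ⟨x, hx, p, hp, hps⟩ := exists_walk_of_mem_ballFrom huX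
    obtain ⟨y, hy, q, hq, hqs⟩ := exists_walk_of_mem_ballFrom huY
    refine (Nat.find_min' hex ⟨x, hx, y, hy, p.append q.reverse, rfl, fun z hz => ?_⟩).trans ?_
    · rw [SimpleGraph.Walk.mem_support_append_iff, SimpleGraph.Walk.support_reverse,
        List.mem_reverse] at hz
      rcases hz with hz | hz
      · exact Finset.union_subset hXW subset_rfl (ballFrom_subset G W X τ (hps z hz))
      · exact Finset.union_subset hYW subset_rfl (ballFrom_subset G W Y τ (hqs z hz))
    · rw [SimpleGraph.Walk.length_append, SimpleGraph.Walk.length_reverse]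
      omega
  obtain ⟨x, hx, y, hy, w, hw, hs⟩ := Nat.find_spec hex
  refine ⟨x, hx, y, hy, w.bypass, w.bypass_isPath, ?_, ?_, ?_, ?_⟩
  · exact w.length_bypass_le_length.trans (hw.trans_le hle)
  · exact fun z hz => hs z (w.support_bypass_subset_support hz)
  · intro z hz hzX
    replace hz := w.support_bypass_subset_support hz
    by_contra hne
    have := SimpleGraph.Walk.length_dropUntil_lt_length hz hne
    have := Nat.find_min' hex ⟨z, hzX, y, hy, w.dropUntil z hz, rfl,
      fun t ht => hs t (w.support_dropUntil_subset_support hz ht)⟩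
    omega
  · intro z hz hzY
    replace hz := w.support_bypass_subset_support hz
    by_contra hne
    have := SimpleGraph.Walk.length_takeUntil_lt_length hz hne
    have := Nat.find_min' hex ⟨x, hx, z, hzY, w.takeUntil z hz, rfl,
      fun t ht => hs t (w.support_takeUntil_subset_support hz ht)⟩
    omega

lemma Expands.exists_rooted_avoiding {G : SimpleGraph V} {e : ℝ} (hE : Expands G e) (he : 0 < e)
    (he1 : e ≤ 1) {τ : ℕ} (hτ : (Fintype.card V : ℝ) < (1 + e / 2) ^ τ) {S : Finset V}
    (hV : 0 < Fintype.card V) (hS : 8 * (S.card : ℝ) ≤ e * Fintype.card V) :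
    ∃ v T, Rooted G T v τ ∧ Disjoint T S ∧ Fintype.card V ≤ 4 * T.card := by
  set n := Fintype.card V with hn
  have hnR : (0 : ℝ) < n := by exact_mod_cast hV
  obtain ⟨Z, hZ, hmax⟩ := (Finset.univ.filter fun Z : Finset V =>
      Disjoint Z S ∧ 2 * Z.card ≤ n ∧
        ((nbIn G Sᶜ Z).card : ℝ) ≤ e / 2 * Z.card).exists_max_image Finset.card
    ⟨∅, by
      simp only [Finset.mem_filter, Finset.mem_univ, true_and]
      exact ⟨Finset.disjoint_empty_left _, by simp, by simp [nbIn]⟩⟩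
  simp only [Finset.mem_filter, Finset.mem_univ, true_and] at hZ hmax
  obtain ⟨hZS, hZn, hZe⟩ := hZ
  have hZcard : 4 * (Z.card : ℝ) ≤ n := by
    rcases Z.eq_empty_or_nonempty with rfl | hne
    · simp
    · have := hE.le_card_nbIn_add Sᶜ hne hZn
      rw [compl_compl] at this
      nlinarith
  have hZcard' : 4 * Z.card ≤ n := by exact_mod_cast hZcard
  have hScard : 8 * S.card ≤ n := by
    have : 8 * (S.card : ℝ) ≤ n := by nlinarith
    exact_mod_cast this
  obtain ⟨v, hv⟩ : ∃ v, v ∉ S ∪ Z := by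
    by_contra! hall
    have h1 : (S ∪ Z) = Finset.univ := Finset.eq_univ_of_forall hall
    have h2 := Finset.card_union_le S Z
    rw [h1, Finset.card_univ] at h2
    omega
  have hv' : v ∈ (S ∪ Z)ᶜ := Finset.mem_compl.2 hv
  refine ⟨v, ballFrom G (S ∪ Z)ᶜ {v} τ, ?_, ?_, ?_⟩
  · simpa using (rooted_singleton G v).ballFrom (S ∪ Z)ᶜ τ
  · rw [Finset.disjoint_left]
    intro u hu huS
    have := ballFrom_subset G (S ∪ Z)ᶜ {v} τ hu
    rw [Finset.mem_union, Finset.mem_singleton, Finset.mem_compl] at this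
    rcases this with rfl | this
    · exact hv (Finset.mem_union_left _ huS)
    · exact this (Finset.mem_union_left _ huS)
  · have := lt_card_ballFrom (G := G) (W := (S ∪ Z)ᶜ) (M := n / 4) (half_pos he)
      (Finset.singleton_nonempty v) hτ ?_
    · omega
    intro Y hvY hY hYn
    have hYc : ∀ y ∈ Y, y ∉ S ∧ y ∉ Z := by
      intro y hy
      have := Finset.union_subset (Finset.singleton_subset_iff.2 hv') subset_rfl (hY hy)
      simpa [not_or] using this
    have hYZ : Disjoint Z Y := Finset.disjoint_left.2 fun y hyZ hy => (hYc y hy).2 hyZ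
    have hcard := Finset.card_union_of_disjoint hYZ
    have hYpos : 0 < Y.card := Finset.card_pos.2 ⟨v, hvY (by simp)⟩
    by_contra! hlt
    have hsub : nbIn G Sᶜ (Z ∪ Y) ⊆ nbIn G Sᶜ Z ∪ nbIn G (S ∪ Z)ᶜ Y := by
      intro u hu
      obtain ⟨huS, huZY, w, hw, hadj⟩ := mem_nbIn.1 hu
      rw [Finset.mem_union, not_or] at huZY
      rw [Finset.mem_union, mem_nbIn, mem_nbIn]
      rcases Finset.mem_union.1 hw with hw | hw
      · exact Or.inl ⟨huS, huZY.1, w, hw, hadj⟩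
      · refine Or.inr ⟨?_, huZY.2, w, hw, hadj⟩
        rw [Finset.mem_compl] at huS ⊢
        simp [huS, huZY.1]
    have hsub' := (Finset.card_le_card hsub).trans (Finset.card_union_le _ _)
    have hsub'' : ((nbIn G Sᶜ (Z ∪ Y)).card : ℝ) ≤
        (nbIn G Sᶜ Z).card + (nbIn G (S ∪ Z)ᶜ Y).card := by exact_mod_cast hsub'
    have := hmax (Z ∪ Y) ⟨?_, by omega, ?_⟩
    · omega
    · exact Finset.disjoint_union_left.2
        ⟨hZS, Finset.disjoint_left.2 fun y hy => (hYc y hy).1⟩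
    · rw [hcard]
      push_cast
      linarith

lemma Expands.exists_path_extension {G : SimpleGraph V} {e : ℝ} (hE : Expands G e) (he : 0 < e)
    {τ : ℕ} (hτ : (Fintype.card V : ℝ) < (1 + e / 2) ^ τ) {a z : V} {p : G.Walk a z}
    (hp : p.IsPath) {C T B : Finset V} {r : ℕ} (hz : z ∈ C) (hC : DiamLE G C r)
    (hpC : ∀ x ∈ p.support, x ∈ C → x = z) (hT : T.Nonempty) (hCT : Disjoint C T)
    (hpT : ∀ x ∈ p.support, x ∉ T) (hCB : Disjoint C B) (hTB : Disjoint T B)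
    (hpB : ∀ x ∈ p.support, x ∉ B)
    (hcC : 2 * ((B.card : ℝ) + p.length) ≤ e * C.card)
    (hcT : 2 * ((B.card : ℝ) + p.length) ≤ e * T.card) :
    ∃ t ∈ T, ∃ q : G.Walk a t, q.IsPath ∧ p.length + 1 ≤ q.length ∧
      q.length ≤ p.length + r + 2 * τ ∧ (∀ x ∈ q.support, x ∈ T → x = t) ∧
      ∀ x ∈ q.support, x ∉ B := by
  set S := B ∪ p.support.toFinset.erase z with hS
  have hScard : ((Sᶜᶜ.card : ℕ) : ℝ) ≤ B.card + p.length := by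
    rw [compl_compl]
    have h1 := Finset.card_union_le B (p.support.toFinset.erase z)
    have h2 : (p.support.toFinset.erase z).card + 1 = p.support.toFinset.card :=
      Finset.card_erase_add_one (by simp)
    have h3 := List.toFinset_card_le p.support
    rw [SimpleGraph.Walk.length_support] at h3
    exact_mod_cast h1.trans (by omega)
  have hdisj : ∀ {X : Finset V}, (∀ x ∈ p.support, x ∈ X → x = z) → Disjoint X B → X ⊆ Sᶜ := by
    intro X hpX hXB x hx
    rw [hS, Finset.mem_compl, Finset.mem_union, Finset.mem_erase, List.mem_toFinset]
    rintro (h | ⟨h1, h2⟩)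
    · exact Finset.disjoint_left.1 hXB hx h
    · exact h1 (hpX x h2 hx)
  obtain ⟨c, hc, t, ht, w, hw, hwl, hwS, hwC, hwT⟩ :=
    hE.exists_connecting_path he hτ (W := Sᶜ) ⟨z, hz⟩ hT (hdisj hpC hCB)
      (hdisj (fun x hx hxT => absurd hxT (hpT x hx)) hTB) (by linarith) (by linarith)
  obtain ⟨u, hul, huC⟩ := hC z hz c hc
  have hbC : ∀ x ∈ u.bypass.support, x ∈ C := fun x hx => huC x (u.support_bypass_subset_support hx)
  have hbl := u.length_bypass_le_length
  have hwpos : 0 < w.length := by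
    by_contra! h0
    have := SimpleGraph.Walk.eq_of_length_eq_zero (p := w) (by omega)
    exact Finset.disjoint_left.1 hCT hc (this ▸ ht)
  have hwmem : ∀ x ∈ w.support, x ∉ B ∧ (x ∈ p.support → x = z) := by
    intro x hx
    have := hwS x hx
    rw [hS, Finset.mem_compl, Finset.mem_union, Finset.mem_erase, List.mem_toFinset, not_or] at this
    exact ⟨this.1, fun h => by_contra fun h' => this.2 ⟨h', h⟩⟩
  refine ⟨t, ht, (p.append u.bypass).append w, isPath_append (isPath_append hp u.bypass_isPath
    fun x hx hx' => hpC x hx (hbC x hx')) hw fun x hx hx' => hwC x hx' ?_, ?_, ?_,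
    fun x hx hxT => ?_, fun x hx => ?_⟩
  · rcases (SimpleGraph.Walk.mem_support_append_iff _ _).1 hx with hx | hx
    · exact (hwmem x hx').2 hx ▸ hz
    · exact hbC x hx
  · rw [SimpleGraph.Walk.length_append, SimpleGraph.Walk.length_append]
    omega
  · rw [SimpleGraph.Walk.length_append, SimpleGraph.Walk.length_append]
    omega
  · rw [SimpleGraph.Walk.mem_support_append_iff, SimpleGraph.Walk.mem_support_append_iff] at hx
    rcases hx with (hx | hx) | hx
    · exact absurd hxT (hpT x hx)
    · exact absurd hxT (Finset.disjoint_left.1 hCT (hbC x hx))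
    · exact hwT x hx hxT
  · rw [SimpleGraph.Walk.mem_support_append_iff, SimpleGraph.Walk.mem_support_append_iff] at hx
    rcases hx with (hx | hx) | hx
    · exact hpB x hx
    · exact Finset.disjoint_left.1 hCB (hbC x hx)
    · exact (hwmem x hx).1

lemma Expands.exists_long_path {G : SimpleGraph V} {e : ℝ} (hE : Expands G e) (he : 0 < e)
    (he1 : e ≤ 1) {τ : ℕ} (hτ : (Fintype.card V : ℝ) < (1 + e / 2) ^ τ) {v : V}
    {C₀ B : Finset V} {r K L : ℕ} (hv : v ∈ C₀) (hC₀ : DiamLE G C₀ r) (hK : C₀.card = K)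
    (hr : 2 * τ ≤ r) (hCB : Disjoint C₀ B)
    (h₁ : 2 * ((B.card : ℝ) + (L + r + 2 * τ)) ≤ e * K)
    (h₂ : 8 * ((B.card : ℝ) + (L + r + 2 * τ) + 1 + K) ≤ e * Fintype.card V)
    (h₃ : 4 * K ≤ Fintype.card V) :
    ∀ j ≤ L, ∃ (z : V) (C : Finset V) (p : G.Walk v z), p.IsPath ∧ j ≤ p.length ∧
      p.length ≤ j + r + 2 * τ ∧ z ∈ C ∧ DiamLE G C r ∧ C.card = K ∧ Disjoint C B ∧
      (∀ x ∈ p.support, x ∈ C → x = z) ∧ ∀ x ∈ p.support, x ∉ B := by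
  have hKpos : 0 < K := hK ▸ Finset.card_pos.2 ⟨v, hv⟩
  intro j
  induction j with
  | zero =>
    intro _
    exact ⟨v, C₀, .nil, by simp, by simp, by simp, hv, hC₀, hK, hCB, by simp, by
      simpa using Finset.disjoint_left.1 hCB hv⟩
  | succ j ih =>
    intro hj
    obtain ⟨z, C, p, hp, hjp, hpj, hz, hC, hCK, hCB', hpC, hpB⟩ := ih (by omega)
    by_cases hlen : j + 1 ≤ p.length
    · exact ⟨z, C, p, hp, hlen, by omega, hz, hC, hCK, hCB', hpC, hpB⟩
    have hpL : (p.length : ℝ) ≤ L + r + 2 * τ := by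
      have : p.length ≤ L + r + 2 * τ := by omega
      exact_mod_cast this
    have hScard : (((B ∪ C ∪ p.support.toFinset).card : ℕ) : ℝ) ≤ B.card + p.length + 1 + K := by
      have h1 := Finset.card_union_le (B ∪ C) p.support.toFinset
      have h2 := Finset.card_union_le B C
      have h3 := List.toFinset_card_le p.support
      rw [SimpleGraph.Walk.length_support] at h3
      exact_mod_cast h1.trans (by omega)
    obtain ⟨u, T, hT, hTS, hTn⟩ := hE.exists_rooted_avoiding he he1 hτ
      (S := B ∪ C ∪ p.support.toFinset) (by omega) (by linarith)
    obtain ⟨T', hT'T, hT'K, hT'⟩ := Rooted.exists_subset_card hKpos (T.card - K) (by omega) hT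
    replace hTS := Finset.disjoint_of_subset_left hT'T hTS
    rw [Finset.disjoint_union_right, Finset.disjoint_union_right] at hTS
    obtain ⟨⟨hTB, hTC⟩, hTp⟩ := hTS
    obtain ⟨t, ht, q, hq, hql, hqu, hqT, hqB⟩ := hE.exists_path_extension he hτ hp hz hC hpC
      ⟨u, hT'.1⟩ hTC.symm
      (fun x hx hxT => Finset.disjoint_left.1 hTp hxT (List.mem_toFinset.2 hx)) hCB' hTB hpB
      (by rw [hCK]; linarith) (by rw [hT'K]; linarith)
    exact ⟨t, T', q, hq, by omega, by omega, ht, hT'.diamLE hr, hT'K, hTB, hqT, hqB⟩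

lemma Expands.exists_path_of_large_left {G : SimpleGraph V} {e : ℝ} (hE : Expands G e)
    (he : 0 < e) (he1 : e ≤ 1) {τ : ℕ} (hτ : (Fintype.card V : ℝ) < (1 + e / 2) ^ τ) {v v' : V}
    {T F B : Finset V} {r K K' L : ℕ} (hT : Rooted G T v (r + τ)) (hF : Rooted G F v' r)
    (hTF : Disjoint T F) (hTB : Disjoint T B) (hFB : Disjoint F B)
    (hTn : Fintype.card V ≤ 4 * T.card)
    (h₁ : 2 * ((B.card : ℝ) + (r + τ + 1)) ≤ e * F.card)
    (h₂ : 2 ≤ K') (h₃ : K' ≤ K) (h₄ : 16 * K ≤ Fintype.card V)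
    (h₅ : 2 * ((B.card : ℝ) + K' + (L + 2 * r + 4 * τ)) ≤ e * K)
    (h₆ : 8 * ((B.card : ℝ) + K' + (L + 2 * r + 4 * τ) + 1 + K) ≤ e * Fintype.card V)
    (h₇ : 2 * ((B.card : ℝ) + (L + 2 * r + 4 * τ)) ≤ e * K') :
    ∃ p : G.Walk v v', p.IsPath ∧ (∀ x ∈ p.support, x ∉ B) ∧ L ≤ p.length ∧
      p.length ≤ L + 6 * r + 10 * τ := by
  have hcast : ∀ {a b : ℝ}, a ≤ b → e * a ≤ e * b := fun h => mul_le_mul_of_nonneg_left h he.le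
  obtain ⟨par, hpar⟩ := hT.exists_isParent
  obtain ⟨stem, hstemT, hvstem, hstemcard, hstem⟩ := hpar.exists_heavy hT.1
  have hFstem : Disjoint F stem := Finset.disjoint_of_subset_right hstemT hTF.symm
  have hstemcard' : (stem.card : ℝ) ≤ r + τ + 1 := by exact_mod_cast hstemcard
  have hW : (((B ∪ stem)ᶜᶜ.card : ℕ) : ℝ) ≤ B.card + stem.card := by
    rw [compl_compl]
    exact_mod_cast Finset.card_union_le B stem
  have hYn := hE.lt_two_mul_card_ballFrom he hτ (W := (B ∪ stem)ᶜ) ⟨v', hF.1⟩ (by linarith)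
  have hYr := hF.ballFrom (B ∪ stem)ᶜ τ
  have hYW : ∀ y ∈ Balanced.ballFrom G (B ∪ stem)ᶜ F τ, y ∉ B ∧ y ∉ stem := by
    intro y hy
    rcases Finset.mem_union.1 (ballFrom_subset G (B ∪ stem)ᶜ F τ hy) with hy | hy
    · exact ⟨Finset.disjoint_left.1 hFB hy, Finset.disjoint_left.1 hFstem hy⟩
    · simpa [not_or] using hy
  obtain ⟨T₁, T₂, hT₁₂, hT₁T, hT₂, hT₁, hT₂r, hT₂K, hTcard⟩ := hpar.exists_split hT.1 hvstem hstem
    hYr (Finset.disjoint_left.2 fun y hy => (hYW y hy).2) (Finset.disjoint_right.1 hTF hF.1) h₂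
    (by omega)
  obtain ⟨C, hCT, hCK, hC⟩ := Rooted.exists_subset_card (by omega : 1 ≤ K) (T₁.card - K)
    (by omega) hT₁
  obtain ⟨R, hRT, hRK, hR⟩ := Rooted.exists_subset_card (by omega : 1 ≤ K') (T₂.card - K')
    (by omega) hT₂r
  have hCR : Disjoint C R := Finset.disjoint_of_subset_left hCT
    (Finset.disjoint_of_subset_right hRT hT₁₂)
  have hCB : Disjoint C B := Finset.disjoint_of_subset_left (hCT.trans hT₁T) hTB
  have hRB : Disjoint R B := Finset.disjoint_left.2 fun x hx => by
    rcases Finset.mem_union.1 (hT₂ (hRT hx)) with hx | hx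
    · exact (hYW x hx).1
    · exact Finset.disjoint_left.1 hTB hx
  have hBR : (((B ∪ R).card : ℕ) : ℝ) ≤ B.card + K' := by
    rw [← hRK]
    exact_mod_cast Finset.card_union_le B R
  obtain ⟨z, D, p, hp, hLp, hpL, hz, hD, hDK, hDBR, hpD, hpBR⟩ :=
    hE.exists_long_path he he1 hτ (L := L) (r := 2 * (r + τ)) hC.1 (hC.diamLE le_rfl) hCK
      (by omega) (Finset.disjoint_union_right.2 ⟨hCB, hCR⟩) (by push_cast; linarith)
      (by push_cast; linarith) (by omega) L le_rfl
  rw [Finset.disjoint_union_right] at hDBR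
  have hpL' : (p.length : ℝ) ≤ L + 2 * r + 4 * τ := by
    have : p.length ≤ L + 2 * r + 4 * τ := by omega
    exact_mod_cast this
  have hK'K : (K' : ℝ) ≤ K := by exact_mod_cast h₃
  obtain ⟨t, ht, q, hq, hpq, hqp, hqR, hqB⟩ := hE.exists_path_extension he hτ hp hz hD hpD
    (T := R) ⟨v', hR.1⟩ hDBR.2 (fun x hx hxR => hpBR x hx (Finset.mem_union_right _ hxR)) hDBR.1 hRB
    (fun x hx hxB => hpBR x hx (Finset.mem_union_left _ hxB))
    (by have := hcast hK'K; rw [hDK]; linarith) (by rw [hRK]; linarith)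
  obtain ⟨w, hw, hwR⟩ := hR.2 t ht
  have hbR : ∀ x ∈ w.bypass.reverse.support, x ∈ R := fun x hx =>
    hwR x (w.support_bypass_subset_support (by simpa using hx))
  have hbl := w.length_bypass_le_length
  refine ⟨q.append w.bypass.reverse, isPath_append hq w.bypass_isPath.reverse
    fun x hx hx' => hqR x hx (hbR x hx'), fun x hx => ?_, ?_, ?_⟩
  · rcases (SimpleGraph.Walk.mem_support_append_iff _ _).1 hx with hx | hx
    · exact hqB x hx
    · exact Finset.disjoint_left.1 hRB (hbR x hx)
  · rw [SimpleGraph.Walk.length_append]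
    omega
  · rw [SimpleGraph.Walk.length_append, SimpleGraph.Walk.length_reverse]
    omega

lemma Expands.exists_path_between {G : SimpleGraph V} {e : ℝ} (hE : Expands G e)
    (he : 0 < e) (he1 : e ≤ 1) {τ : ℕ} (hτ : (Fintype.card V : ℝ) < (1 + e / 2) ^ τ) {v v' : V}
    {F F' B : Finset V} {r D K K' L : ℕ} (hF : Rooted G F v r) (hF' : Rooted G F' v' r)
    (hFF' : Disjoint F F') (hFB : Disjoint F B) (hFB' : Disjoint F' B) (hFD : F.card = D)
    (hFD' : F'.card = D)
    (h₁ : 2 * ((B.card : ℝ) + (r + τ + 1)) ≤ e * D)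
    (h₂ : 2 ≤ K') (h₃ : K' ≤ K) (h₄ : 16 * K ≤ Fintype.card V)
    (h₅ : 2 * ((B.card : ℝ) + K' + (L + 2 * r + 4 * τ)) ≤ e * K)
    (h₆ : 8 * ((B.card : ℝ) + K' + (L + 2 * r + 4 * τ) + 1 + K) ≤ e * Fintype.card V)
    (h₇ : 2 * ((B.card : ℝ) + (L + 2 * r + 4 * τ)) ≤ e * K') :
    ∃ p : G.Walk v v', p.IsPath ∧ (∀ x ∈ p.support, x ∉ B) ∧ L ≤ p.length ∧
      p.length ≤ L + 6 * r + 10 * τ := by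
  obtain ⟨T, T', hTT', hFT, hFT', hball, hT, hT'⟩ :=
    hF.exists_disjoint_growth (W := Bᶜ) hF' hFF' τ
  have hsub := ballFrom_subset G Bᶜ (F ∪ F') τ
  have hballB : ∀ x ∈ Balanced.ballFrom G Bᶜ (F ∪ F') τ, x ∉ B := by
    intro x hx
    rcases Finset.mem_union.1 (hsub hx) with hx | hx
    · exact Finset.disjoint_left.1 (Finset.disjoint_union_left.2 ⟨hFB, hFB'⟩) hx
    · exact Finset.mem_compl.1 hx
  rw [← hball] at hballB
  have hTB : Disjoint T B :=
    Finset.disjoint_left.2 fun x hx => hballB x (Finset.mem_union_left _ hx)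
  have hTB' : Disjoint T' B :=
    Finset.disjoint_left.2 fun x hx => hballB x (Finset.mem_union_right _ hx)
  have hlarge := hE.lt_two_mul_card_ballFrom he hτ (W := Bᶜ) (X := F ∪ F')
    ⟨v, Finset.mem_union_left _ hF.1⟩ (by
      have hc : (D : ℝ) ≤ ((F ∪ F').card : ℕ) := by
        rw [← hFD]
        exact_mod_cast Finset.card_le_card Finset.subset_union_left
      have := mul_le_mul_of_nonneg_left hc he.le
      rw [compl_compl]
      have : (0 : ℝ) ≤ r + τ + 1 := by positivity
      linarith)
  rw [← hball, Finset.card_union_of_disjoint hTT'] at hlarge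
  rcases le_total T'.card T.card with hle | hle
  · exact hE.exists_path_of_large_left he he1 hτ hT hF'
      (Finset.disjoint_of_subset_right hFT' hTT') hTB hFB' (by omega) (by rw [hFD']; exact h₁)
      h₂ h₃ h₄ h₅ h₆ h₇
  · obtain ⟨p, hp, hpB, hLp, hpL⟩ := hE.exists_path_of_large_left he he1 hτ hT' hF
      (Finset.disjoint_of_subset_right hFT hTT'.symm) hTB' hFB (by omega) (by rw [hFD]; exact h₁)
      h₂ h₃ h₄ h₅ h₆ h₇
    exact ⟨p.reverse, hp.reverse, fun x hx => hpB x (by simpa using hx), by simpa using hLp,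
      by simpa using hpL⟩

/-- A path from `S` to `T` extends to one between the roots, and the other two rooted sets are
then joined by a path of suitable length. -/
lemma Expands.exists_path_pair_of_connector {G : SimpleGraph V} {e : ℝ} (hE : Expands G e)
    (he : 0 < e) (he1 : e ≤ 1) {τ : ℕ} (hτ : (Fintype.card V : ℝ) < (1 + e / 2) ^ τ)
    {S S' T T' A : Finset V} {s s' t t' x y : V} {r D K K' ℓ : ℕ}
    (hS : Rooted G S s r) (hS' : Rooted G S' s' r) (hT : Rooted G T t r) (hT' : Rooted G T' t' r)
    (hSS' : Disjoint S S') (hST : Disjoint S T) (hST' : Disjoint S T') (hS'T : Disjoint S' T)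
    (hS'T' : Disjoint S' T') (hTT' : Disjoint T T') (hSA : Disjoint S A) (hSA' : Disjoint S' A)
    (hTA : Disjoint T A) (hTA' : Disjoint T' A) (hSD : S'.card = D) (hTD : T'.card = D)
    (h₁ : 2 * (((A.card : ℝ) + (2 * r + 2 * τ + 1)) + (r + τ + 1)) ≤ e * D)
    (h₂ : 2 ≤ K') (h₃ : K' ≤ K) (h₄ : 16 * K ≤ Fintype.card V)
    (h₅ : 2 * (((A.card : ℝ) + (2 * r + 2 * τ + 1)) + K' + (ℓ + 2 * r + 4 * τ)) ≤ e * K)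
    (h₆ : 8 * (((A.card : ℝ) + (2 * r + 2 * τ + 1)) + K' + (ℓ + 2 * r + 4 * τ) + 1 + K)
      ≤ e * Fintype.card V)
    (h₇ : 2 * (((A.card : ℝ) + (2 * r + 2 * τ + 1)) + (ℓ + 2 * r + 4 * τ)) ≤ e * K')
    (hx : x ∈ S) (hy : y ∈ T) (w : G.Walk x y) (hw : w.IsPath) (hwl : w.length ≤ 2 * τ)
    (hwA : ∀ z ∈ w.support, z ∉ A) (hwS : ∀ z ∈ w.support, z ∈ S ∪ S' → z = x)
    (hwT : ∀ z ∈ w.support, z ∈ T ∪ T' → z = y) :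
    ∃ (P : G.Walk s' t') (Q : G.Walk s t), P.IsPath ∧ Q.IsPath ∧
      (∀ z ∈ P.support, z ∉ Q.support) ∧ (∀ z ∈ P.support, z ∉ A) ∧ (∀ z ∈ Q.support, z ∉ A) ∧
      ℓ ≤ P.length + Q.length ∧ P.length + Q.length ≤ ℓ + 8 * r + 12 * τ := by
  obtain ⟨p, hp, hpl, hps⟩ := hS.exists_path hx
  obtain ⟨q, hq, hql, hqs⟩ := hT.exists_path hy
  rw [Finset.disjoint_left] at hSS' hST hST' hS'T hS'T' hTT' hSA hSA' hTA hTA'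
  have hpw : (p.append w).IsPath := isPath_append hp hw
    (fun z hz hz' => hwS z hz' (Finset.mem_union_left _ (hps z hz)))
  set Q := (p.append w).append q.reverse with hQ
  have hQmem : ∀ z, z ∈ Q.support ↔ (z ∈ p.support ∨ z ∈ w.support) ∨ z ∈ q.support := by
    intro z
    simp [hQ, SimpleGraph.Walk.mem_support_append_iff]
  have hQp : Q.IsPath := by
    refine isPath_append hpw hq.reverse (fun z hz hz' => ?_)
    have hzq : z ∈ T := hqs z (by simpa using hz')
    rcases (SimpleGraph.Walk.mem_support_append_iff _ _).1 hz with h | h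
    · exact absurd hzq (hST (hps z h))
    · exact hwT z h (Finset.mem_union_left _ hzq)
  have hQl : Q.length ≤ 2 * r + 2 * τ := by
    simp only [hQ, SimpleGraph.Walk.length_append, SimpleGraph.Walk.length_reverse]
    omega
  have hQA : ∀ z ∈ Q.support, z ∉ A := by
    intro z hz
    rcases (hQmem z).1 hz with (h | h) | h
    · exact hSA (hps z h)
    · exact hwA z h
    · exact hTA (hqs z h)
  have hQS' : ∀ z ∈ S', z ∉ Q.support := by
    intro z hz hzQ
    rcases (hQmem z).1 hzQ with (h | h) | h
    · exact hSS' (hps z h) hz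
    · have := hwS z h (Finset.mem_union_right _ hz)
      exact hSS' hx (this ▸ hz)
    · exact hS'T hz (hqs z h)
  have hQT' : ∀ z ∈ T', z ∉ Q.support := by
    intro z hz hzQ
    rcases (hQmem z).1 hzQ with (h | h) | h
    · exact hST' (hps z h) hz
    · have := hwT z h (Finset.mem_union_right _ hz)
      exact hTT' hy (this ▸ hz)
    · exact hTT' (hqs z h) hz
  set B := A ∪ Q.support.toFinset with hB
  have hBc : (B.card : ℝ) ≤ A.card + (2 * r + 2 * τ + 1) := by
    have h1 : B.card ≤ _ := Finset.card_union_le A Q.support.toFinset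
    have h2 := Q.support.toFinset_card_le
    rw [SimpleGraph.Walk.length_support] at h2
    have h3 : B.card ≤ A.card + (2 * r + 2 * τ + 1) := by omega
    exact_mod_cast h3
  have hLl : ((ℓ - Q.length : ℕ) : ℝ) ≤ ℓ := by exact_mod_cast Nat.sub_le _ _
  obtain ⟨P, hP, hPB, hlP, hPl⟩ := hE.exists_path_between he he1 hτ (B := B) (L := ℓ - Q.length)
    hS' hT' (Finset.disjoint_left.2 hS'T')
    (Finset.disjoint_left.2 fun z hz hzB => by
      rcases Finset.mem_union.1 hzB with h | h
      · exact hSA' hz h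
      · exact hQS' z hz (by simpa using h))
    (Finset.disjoint_left.2 fun z hz hzB => by
      rcases Finset.mem_union.1 hzB with h | h
      · exact hTA' hz h
      · exact hQT' z hz (by simpa using h))
    hSD hTD (by linarith) h₂ h₃ h₄ (by linarith) (by linarith) (by linarith)
  refine ⟨P, Q, hP, hQp, fun z hz hzQ => hPB z hz ?_, fun z hz hzA => hPB z hz ?_, hQA,
    by omega, by omega⟩
  · exact Finset.mem_union_right _ (by simpa using hzQ)
  · exact Finset.mem_union_left _ hzA

/-- Four disjoint rooted sets in an expander are joined in pairs by two disjoint paths of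
prescribed total length. -/
lemma Expands.exists_path_pair {G : SimpleGraph V} {e : ℝ} (hE : Expands G e)
    (he : 0 < e) (he1 : e ≤ 1) {τ : ℕ} (hτ : (Fintype.card V : ℝ) < (1 + e / 2) ^ τ)
    {F : Fin 4 → Finset V} {A : Finset V} {v : Fin 4 → V} {r D K K' ℓ : ℕ}
    (hF : ∀ i, Rooted G (F i) (v i) r) (hFF : ∀ i j, i ≠ j → Disjoint (F i) (F j))
    (hFA : ∀ i, Disjoint (F i) A) (hFD : ∀ i, (F i).card = D)
    (h₁ : 2 * (((A.card : ℝ) + (2 * r + 2 * τ + 1)) + (r + τ + 1)) ≤ e * D)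
    (h₂ : 2 ≤ K') (h₃ : K' ≤ K) (h₄ : 16 * K ≤ Fintype.card V)
    (h₅ : 2 * (((A.card : ℝ) + (2 * r + 2 * τ + 1)) + K' + (ℓ + 2 * r + 4 * τ)) ≤ e * K)
    (h₆ : 8 * (((A.card : ℝ) + (2 * r + 2 * τ + 1)) + K' + (ℓ + 2 * r + 4 * τ) + 1 + K)
      ≤ e * Fintype.card V)
    (h₇ : 2 * (((A.card : ℝ) + (2 * r + 2 * τ + 1)) + (ℓ + 2 * r + 4 * τ)) ≤ e * K') :
    ∃ a b a' b' : V, a ∈ ({v 0, v 1} : Set V) ∧ b ∈ ({v 2, v 3} : Set V) ∧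
      a' ∈ ({v 0, v 1} : Set V) ∧ b' ∈ ({v 2, v 3} : Set V) ∧
      ∃ (P : G.Walk a b) (Q : G.Walk a' b'), P.IsPath ∧ Q.IsPath ∧
        (∀ z ∈ P.support, z ∉ Q.support) ∧ (∀ z ∈ P.support, z ∉ A) ∧ (∀ z ∈ Q.support, z ∉ A) ∧
        ℓ ≤ P.length + Q.length ∧ P.length + Q.length ≤ ℓ + 8 * r + 12 * τ := by
  have hsub : ∀ i j, F i ∪ F j ⊆ Aᶜ := fun i j z hz => by
    rw [Finset.mem_compl]
    rcases Finset.mem_union.1 hz with h | h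
    exacts [Finset.disjoint_left.1 (hFA i) h, Finset.disjoint_left.1 (hFA j) h]
  have hcard : ∀ i j, 2 * ((Aᶜᶜ : Finset V).card : ℝ) ≤ e * (F i ∪ F j).card := fun i j => by
    rw [compl_compl]
    have h1 : (D : ℝ) ≤ (F i ∪ F j).card := by
      exact_mod_cast (hFD i) ▸ Finset.card_le_card Finset.subset_union_left
    have h2 : e * D ≤ e * (F i ∪ F j).card := by gcongr
    have h3 : (0 : ℝ) ≤ r := Nat.cast_nonneg r
    have h4 : (0 : ℝ) ≤ τ := Nat.cast_nonneg τ
    linarith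
  obtain ⟨x, hx, y, hy, w, hw, hwl, hwW, hwX, hwY⟩ := hE.exists_connecting_path he hτ
    (X := F 0 ∪ F 1) (Y := F 2 ∪ F 3) ⟨v 0, Finset.mem_union_left _ (hF 0).1⟩
    ⟨v 2, Finset.mem_union_left _ (hF 2).1⟩ (hsub 0 1) (hsub 2 3) (hcard 0 1) (hcard 2 3)
  have hwA : ∀ z ∈ w.support, z ∉ A := fun z hz => by simpa using hwW z hz
  have main : ∀ i i' j j' : Fin 4, i ≠ i' → i ≠ j → i ≠ j' → i' ≠ j → i' ≠ j' → j ≠ j' →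
      F i ∪ F i' = F 0 ∪ F 1 → F j ∪ F j' = F 2 ∪ F 3 → x ∈ F i → y ∈ F j →
      ∃ (P : G.Walk (v i') (v j')) (Q : G.Walk (v i) (v j)), P.IsPath ∧ Q.IsPath ∧
        (∀ z ∈ P.support, z ∉ Q.support) ∧ (∀ z ∈ P.support, z ∉ A) ∧ (∀ z ∈ Q.support, z ∉ A) ∧
        ℓ ≤ P.length + Q.length ∧ P.length + Q.length ≤ ℓ + 8 * r + 12 * τ := by
    intro i i' j j' h1 h2 h3 h4 h5 h6 h01 h23 hx hy
    exact hE.exists_path_pair_of_connector he he1 hτ (hF i) (hF i') (hF j) (hF j')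
      (hFF _ _ h1) (hFF _ _ h2) (hFF _ _ h3) (hFF _ _ h4) (hFF _ _ h5) (hFF _ _ h6)
      (hFA i) (hFA i') (hFA j) (hFA j') (hFD i') (hFD j') h₁ h₂ h₃ ‹_› h₅ h₆ h₇ hx hy w hw hwl
      hwA (h01 ▸ hwX) (h23 ▸ hwY)
  rcases Finset.mem_union.1 hx with hx | hx <;> rcases Finset.mem_union.1 hy with hy | hy
  · exact ⟨v 1, v 3, v 0, v 2, by simp, by simp, by simp, by simp,
      main 0 1 2 3 (by decide) (by decide) (by decide) (by decide) (by decide) (by decide)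
        rfl rfl hx hy⟩
  · exact ⟨v 1, v 2, v 0, v 3, by simp, by simp, by simp, by simp,
      main 0 1 3 2 (by decide) (by decide) (by decide) (by decide) (by decide) (by decide)
        rfl (Finset.union_comm _ _) hx hy⟩
  · exact ⟨v 0, v 3, v 1, v 2, by simp, by simp, by simp, by simp,
      main 1 0 2 3 (by decide) (by decide) (by decide) (by decide) (by decide) (by decide)
        (Finset.union_comm _ _) rfl hx hy⟩
  · exact ⟨v 0, v 2, v 1, v 3, by simp, by simp, by simp, by simp,
      main 1 0 3 2 (by decide) (by decide) (by decide) (by decide) (by decide) (by decide)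
        (Finset.union_comm _ _) (Finset.union_comm _ _) hx hy⟩

lemma IsExpander.expands {G : SimpleGraph V} {ε₁ ε₂ d : ℝ} (hG : IsExpander G ε₁ (ε₂ * d))
    (hdeg : MinDegGE G d) (hε₁ : 0 < ε₁) (hε₂ : 0 < ε₂) (hε₂1 : ε₂ < 1)
    (hd : 15 / 2 ≤ ε₂ * d) (he1 : ε₁ / Real.log (Fintype.card V) ^ 2 ≤ 1) :
    Expands G (ε₁ / Real.log (Fintype.card V) ^ 2) := by
  have hd0 : 0 < d := by
    by_contra! h
    nlinarith
  intro X hX hX2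
  have hXpos : (0 : ℝ) < X.card := by exact_mod_cast hX.card_pos
  have hXn : 2 * (X.card : ℝ) ≤ Fintype.card V := by exact_mod_cast hX2
  rcases lt_or_ge (X.card : ℝ) (ε₂ * d / 2) with h | h
  · obtain ⟨v, hv⟩ := hX
    have h1 : G.neighborSet v ⊆ ↑(nbIn G Finset.univ X ∪ X) := by
      intro u hu
      simp only [Finset.coe_union, Set.mem_union, Finset.mem_coe, mem_nbIn]
      by_cases huX : u ∈ X
      · exact .inr huX
      · exact .inl ⟨Finset.mem_univ _, huX, v, hv, hu⟩
    have h2 := Set.ncard_le_ncard h1 (Finset.finite_toSet _)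
    rw [Set.ncard_coe_finset] at h2
    have h3 : ((G.neighborSet v).ncard : ℝ) ≤ (nbIn G Finset.univ X).card + X.card := by
      exact_mod_cast h2.trans (Finset.card_union_le _ _)
    have h4 := hdeg v
    have h5 : ε₁ / Real.log (Fintype.card V) ^ 2 * X.card ≤ 1 * X.card := by gcongr
    nlinarith
  · have h1 := hG (X : Set V) (by rwa [Set.ncard_coe_finset])
      (by rw [Set.ncard_coe_finset, Nat.card_eq_fintype_card]; linarith)
    have h2 : extNbr G (X : Set V) = ↑(nbIn G Finset.univ X) := by
      ext u
      simp [extNbr, mem_nbIn]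
    rw [h2, Set.ncard_coe_finset, Set.ncard_coe_finset, epsFn, if_neg (by linarith)] at h1
    refine le_trans ?_ h1
    have hk : 0 < ε₂ * d := by linarith
    have h3 : 1 < 15 * (X.card : ℝ) / (ε₂ * d) := by
      rw [lt_div_iff₀ hk]
      linarith
    have h4 : 15 * (X.card : ℝ) / (ε₂ * d) ≤ Fintype.card V := by
      rw [div_le_iff₀ hk]
      nlinarith
    have h5 := Real.log_pos h3
    have h6 := Real.log_le_log (by linarith) h4
    gcongr

end Growth

section Sizes

lemma exists_lt_pow {ε L N m : ℝ} (hε : 0 < ε) (hε1 : ε < 1) (hL : 100 ≤ ε * L)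
    (hN : N = Real.exp L) (hm : 100 / ε * L ^ 3 ≤ m) :
    ∃ τ : ℕ, N < (1 + ε / L ^ 2 / 2) ^ τ ∧ 20 * (τ : ℝ) ≤ m := by
  have hL0 : 100 ≤ L := by nlinarith
  have hLpos : 0 < L := by linarith
  obtain ⟨e, he⟩ : ∃ e, e = ε / L ^ 2 := ⟨_, rfl⟩
  rw [← he]
  have he0 : 0 < e := by rw [he]; positivity
  have he1 : e ≤ 1 := by
    rw [he, div_le_one (by positivity)]
    nlinarith
  refine ⟨⌊4 * L / e⌋₊ + 1, ?_, ?_⟩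
  · have h1 : Real.exp (e / 4) ≤ 1 + e / 2 := by
      have h2 := Real.add_one_le_exp (-(e / 4))
      rw [Real.exp_neg] at h2
      have h3 := Real.exp_pos (e / 4)
      have h4 : (-(e / 4) + 1) * Real.exp (e / 4) ≤ 1 := by
        calc _ ≤ (Real.exp (e / 4))⁻¹ * Real.exp (e / 4) := by gcongr
          _ = 1 := inv_mul_cancel₀ h3.ne'
      have h5 : 1 ≤ (1 + e / 2) * (-(e / 4) + 1) := by nlinarith
      have h6 : 0 < -(e / 4) + 1 := by linarith
      nlinarith
    have h2 : 4 * L / e < (⌊4 * L / e⌋₊ + 1 : ℕ) := by exact_mod_cast Nat.lt_floor_add_one _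
    rw [div_lt_iff₀ he0] at h2
    calc N = Real.exp L := hN
      _ < Real.exp ((⌊4 * L / e⌋₊ + 1 : ℕ) * (e / 4)) := by
        apply Real.exp_lt_exp.2
        linarith
      _ = Real.exp (e / 4) ^ (⌊4 * L / e⌋₊ + 1) := Real.exp_nat_mul _ _
      _ ≤ _ := by gcongr
  · have h1 : ((⌊4 * L / e⌋₊ + 1 : ℕ) : ℝ) ≤ 4 * L / e + 1 := by
      push_cast
      gcongr
      exact Nat.floor_le (by positivity)
    have h2 : 4 * L / e = 4 / ε * L ^ 3 := by
      rw [he]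
      field_simp
    have h3 : 1 ≤ 1 / ε * L ^ 3 := by
      have : 1 ≤ 1 / ε := by rw [le_div_iff₀ hε]; linarith
      have : 1 ≤ L ^ 3 := one_le_pow₀ (by linarith)
      nlinarith
    have h4 : 4 / ε = 4 * (1 / ε) := by ring
    have h5 : 100 / ε = 100 * (1 / ε) := by ring
    rw [h5] at hm
    rw [h4] at h2
    linarith

lemma exists_path_sizes {ε L N D a r τ ℓ : ℝ} (hε : 0 < ε) (hε1 : ε < 1) (hL : 100 ≤ ε * L)
    (hD : L ^ 10 ≤ D) (hDN : D ≤ N / L ^ 10) (ha : a ≤ D / L ^ 3) (hr : r ≤ L ^ 4)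
    (hτ : 20 * τ ≤ L ^ 4) (hℓ : ℓ ≤ N / L ^ 10) :
    2 * ((a + (2 * r + 2 * τ + 1)) + (r + τ + 1)) ≤ ε / L ^ 2 * D ∧
    ∃ K K' : ℕ, 2 ≤ K' ∧ K' ≤ K ∧ 16 * (K : ℝ) ≤ N ∧
      2 * ((a + (2 * r + 2 * τ + 1)) + K' + (ℓ + 2 * r + 4 * τ)) ≤ ε / L ^ 2 * K ∧
      8 * ((a + (2 * r + 2 * τ + 1)) + K' + (ℓ + 2 * r + 4 * τ) + 1 + K) ≤ ε / L ^ 2 * N ∧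
      2 * ((a + (2 * r + 2 * τ + 1)) + (ℓ + 2 * r + 4 * τ)) ≤ ε / L ^ 2 * K' := by
  have hL0 : 100 ≤ L := by nlinarith
  have hLpos : 0 < L := by linarith
  obtain ⟨e, he⟩ : ∃ e, e = ε / L ^ 2 := ⟨_, rfl⟩
  rw [← he]
  have he0 : 0 < e := by rw [he]; positivity
  have he1 : e ≤ 1 := by
    rw [he, div_le_one (by positivity)]
    nlinarith
  have heL : 100 ≤ e * L ^ 3 := by
    have : e * L ^ 3 = ε * L := by rw [he]; field_simp
    linarith
  have hL4 : 1 ≤ L ^ 4 := one_le_pow₀ (by linarith)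
  have hDpos : 0 < D := by nlinarith [pow_pos hLpos 10]
  have hDL : L ^ 7 ≤ D / L ^ 3 := by
    rw [le_div_iff₀ (by positivity)]
    calc _ = L ^ 10 := by ring
      _ ≤ D := hD
  have hL7 : L ^ 4 ≤ L ^ 7 := pow_le_pow_right₀ (by linarith) (by norm_num)
  have hDe : 100 * (D / L ^ 3) ≤ e * D := by
    calc 100 * (D / L ^ 3) ≤ (e * L ^ 3) * (D / L ^ 3) := by gcongr
      _ = e * D := by field_simp
  refine ⟨by linarith, ?_⟩
  have hN : 0 < N := by
    have h1 : 0 < N / L ^ 10 := by linarith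
    by_contra! h
    have h2 : N / L ^ 10 ≤ 0 := div_nonpos_of_nonpos_of_nonneg h (by positivity)
    linarith
  have hDL' : D / L ^ 3 ≤ D := div_le_self hDpos.le (one_le_pow₀ (by linarith))
  have hNL : 10 ^ 8 * (N / L ^ 10) ≤ e ^ 3 * N := by
    have h1 : (10 : ℝ) ^ 8 ≤ e ^ 3 * L ^ 10 := by
      calc (10 : ℝ) ^ 8 = 100 ^ 3 * 100 := by norm_num
        _ ≤ (e * L ^ 3) ^ 3 * L := by gcongr
        _ = _ := by ring
    calc _ ≤ (e ^ 3 * L ^ 10) * (N / L ^ 10) := by gcongr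
      _ = e ^ 3 * N := by field_simp
  have hx : e ^ 3 * N ≤ e ^ 2 * N := by
    gcongr ?_ * N
    exact pow_le_pow_of_le_one he0.le he1 (by norm_num)
  have hy : e ^ 2 * N ≤ e * N := by
    gcongr ?_ * N
    nlinarith
  have hz : e * N ≤ N := by nlinarith
  have hK := Nat.floor_le (show 0 ≤ e * N / 64 by positivity)
  have hK1 := Nat.lt_floor_add_one (e * N / 64)
  have hK' := Nat.floor_le (show 0 ≤ e ^ 2 * N / 1024 by positivity)
  have hK1' := Nat.lt_floor_add_one (e ^ 2 * N / 1024)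
  have heK : e * (e * N / 64) ≤ e * (⌊e * N / 64⌋₊ + 1) := by gcongr
  have heK' : e * (e ^ 2 * N / 1024) ≤ e * (⌊e ^ 2 * N / 1024⌋₊ + 1) := by gcongr
  have hL1 : 1 ≤ L ^ 10 := one_le_pow₀ (by linarith)
  refine ⟨⌊e * N / 64⌋₊, ⌊e ^ 2 * N / 1024⌋₊, Nat.le_floor ?_, Nat.floor_le_floor ?_, ?_, ?_, ?_, ?_⟩
  · push_cast
    linarith
  all_goals linarith

end Sizes

lemma IsExpansion.rooted [Fintype V] {G : SimpleGraph V} {F : G.Subgraph} {v : V} {D m : ℝ}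
    (h : IsExpansion G F v D m) : Rooted G F.verts.toFinset v ⌊m⌋₊ := by
  obtain ⟨hv, -, h⟩ := h
  refine ⟨by simpa using hv, fun u hu => ?_⟩
  obtain ⟨w, hw⟩ := h u (by simpa using hu)
  refine ⟨w.map F.hom, (w.length_map F.hom).trans_le (Nat.le_floor hw), fun x hx => ?_⟩
  obtain ⟨y, -, rfl⟩ := List.mem_map.1 ((w.support_map F.hom) ▸ hx)
  simp

end Helpers

/-- two disjoint paths between expansions whose total length is close
to any prescribed value (Lemma 2.11). -/
theorem statement15 :
    ∀ ε₁ ε₂ : ℝ, 0 < ε₁ → ε₁ < 1 → 0 < ε₂ → ε₂ < 1 →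
      ∃ d₀ : ℝ, ∀ (n : ℕ) (d : ℝ), d₀ ≤ d → d ≤ n →
        ∀ (V : Type) [Fintype V] (G : SimpleGraph V), Nat.card V = n →
          IsBip G → IsExpander G ε₁ (ε₂ * d) → MinDegGE G d →
            ∀ D : ℕ, Real.log n ^ 10 ≤ (D : ℝ) → (D : ℝ) ≤ n / Real.log n ^ 10 →
            ∀ m : ℝ, 100 / ε₁ * Real.log n ^ 3 ≤ m → m ≤ Real.log n ^ 4 →
            ∀ ℓ : ℕ, (ℓ : ℝ) ≤ n / Real.log n ^ 10 →
            ∀ A : Set V, (A.ncard : ℝ) ≤ (D : ℝ) / Real.log n ^ 3 →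
            ∀ (F : Fin 4 → G.Subgraph) (vv : Fin 4 → V),
              (∀ i j, i ≠ j → Disjoint (F i).verts (F j).verts) →
              (∀ i, Disjoint (F i).verts A) →
              (∀ i, IsExpansion G (F i) (vv i) (D : ℝ) m) →
              ∃ a b a' b' : V,
                a ∈ ({vv 0, vv 1} : Set V) ∧ b ∈ ({vv 2, vv 3} : Set V) ∧
                a' ∈ ({vv 0, vv 1} : Set V) ∧ b' ∈ ({vv 2, vv 3} : Set V) ∧
                ∃ (P : G.Walk a b) (Q : G.Walk a' b'),
                  P.IsPath ∧ Q.IsPath ∧ Disjoint (suppSet P) (suppSet Q) ∧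
                  (∀ x ∈ P.support, x ∉ A) ∧ (∀ x ∈ Q.support, x ∉ A) ∧
                  (ℓ : ℝ) ≤ (P.length : ℝ) + (Q.length : ℝ) ∧
                  (P.length : ℝ) + (Q.length : ℝ) ≤ (ℓ : ℝ) + 20 * m := by
  classical
  intro ε₁ ε₂ hε₁ hε₁1 hε₂ hε₂1
  refine ⟨Real.exp (100 / ε₁) + 15 / 2 / ε₂, ?_⟩
  intro n d hd hdn V _ G hVn _ hG hdeg D hD hDN m hm hmL ℓ hℓ A hA F vv hFF hFA hF
  have hcard : Fintype.card V = n := by rw [← Nat.card_eq_fintype_card, hVn]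
  have hk : 0 < 15 / 2 / ε₂ := by positivity
  have hexp := Real.exp_pos (100 / ε₁)
  have hn : (0 : ℝ) < n := by linarith
  have hL : 100 ≤ ε₁ * Real.log n := by
    have h1 : 100 / ε₁ ≤ Real.log n := (Real.le_log_iff_exp_le hn).2 (by linarith)
    rwa [div_le_iff₀' hε₁] at h1
  have hkd : 15 / 2 ≤ ε₂ * d := by
    rw [← div_le_iff₀' hε₂]
    linarith
  have hL1 : 100 ≤ Real.log n := by nlinarith
  have he : 0 < ε₁ / Real.log n ^ 2 := by positivity
  have he1 : ε₁ / Real.log n ^ 2 ≤ 1 := by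
    rw [div_le_one (by positivity)]
    nlinarith
  have hE : Expands G (ε₁ / Real.log n ^ 2) := by
    rw [← hcard] at he1 ⊢
    exact hG.expands hdeg hε₁ hε₂ hε₂1 hkd he1
  obtain ⟨τ, hτ, hτm⟩ := exists_lt_pow hε₁ hε₁1 hL (Real.exp_log hn).symm hm
  have hr : (⌊m⌋₊ : ℝ) ≤ m := Nat.floor_le (by linarith [Nat.cast_nonneg (α := ℝ) τ])
  rw [Set.ncard_eq_toFinset_card'] at hA
  obtain ⟨h₁, K, K', h₂, h₃, h₄, h₅, h₆, h₇⟩ := exists_path_sizes hε₁ hε₁1 hL hD hDN hA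
    (hr.trans hmL) (hτm.trans hmL) hℓ
  rw [← hcard] at h₄ h₆ hτ
  obtain ⟨a, b, a', b', ha, hb, ha', hb', P, Q, hP, hQ, hPQ, hPA, hQA, hlow, hup⟩ :=
    hE.exists_path_pair he he1 (F := fun i => (F i).verts.toFinset) (A := A.toFinset) (v := vv)
      (D := D) (K := K) (K' := K') (ℓ := ℓ) (by rwa [← hcard]) (fun i => (hF i).rooted)
      (fun i j hij => Set.disjoint_toFinset.2 (hFF i j hij))
      (fun i => Set.disjoint_toFinset.2 (hFA i))
      (fun i => by
        obtain ⟨-, h, -⟩ := hF i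
        rw [Set.ncard_eq_toFinset_card'] at h
        exact_mod_cast h)
      h₁ h₂ h₃ (by exact_mod_cast h₄) h₅ (by simpa [hcard] using h₆) h₇
  refine ⟨a, b, a', b', ha, hb, ha', hb', P, Q, hP, hQ, Set.disjoint_left.2 hPQ,
    fun x hx => by simpa using hPA x hx, fun x hx => by simpa using hQA x hx,
    by exact_mod_cast hlow, ?_⟩
  have hup' : (P.length : ℝ) + Q.length ≤ ℓ + 8 * ⌊m⌋₊ + 12 * τ := by exact_mod_cast hup
  linarith

end Balanced
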